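/- For each k ≥ 1 let J_k ⊂ K[x_1,…,x_n] be the monomial ideal generated by all monomials x_{i_1} x_{i_2} ⋯ x_{i_k} with i_{l+1} − i_l ≥ 2 for l = 1,…,k−1 (the >_1-chains of degree k). Then for any integers t_1,…,t_p, the product J = J_{t_1} ⋯ J_{t_p} has linear quotients. -/

import Mathlib

open MvPolynomial

/-- An ideal `I ⊆ K[x_1,…,x_n]` has *linear quotients* if it admits a minimal system
of homogeneous generators `m_1, …, m_k` such that each colon ideal
`(m_1, …, m_{t-1}) : m_t` is generated by linear forms. -/
def HasLinearQuotients {K : Type} [Field K] {n : ℕ}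
    (I : Ideal (MvPolynomial (Fin n) K)) : Prop :=
  ∃ (k : ℕ) (m : Fin k → MvPolynomial (Fin n) K) (dg : Fin k → ℕ),
    (∀ t, (m t).IsHomogeneous (dg t)) ∧ (∀ t, m t ≠ 0) ∧
    Ideal.span (Set.range m) = I ∧
    (∀ t, m t ∉ Ideal.span (m '' {t' | t' ≠ t})) ∧
    ∀ t : Fin k, ∃ L : Set (MvPolynomial (Fin n) K), (∀ f ∈ L, f.IsHomogeneous 1) ∧
      (Ideal.span (m '' {t' | t' < t})).colon (Ideal.span {m t}) = Ideal.span L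

/-- The left-greedy selection from exponents `a` subject to the constraint that consecutive
selected exponents sum to at most `k`; the value at `i + 1` is the amount selected from `a i`. -/
def greedySel (k : ℕ) (a : ℕ → ℕ) : ℕ → ℕ
  | 0 => 0
  | i + 1 => min (a i) (k - greedySel k a i)

namespace greedySel

theorem le_apply (k : ℕ) (a : ℕ → ℕ) (i : ℕ) : greedySel k a (i + 1) ≤ a i :=
  min_le_left _ _

theorem le_bound (k : ℕ) (a : ℕ → ℕ) : ∀ i, greedySel k a i ≤ k
  | 0 => Nat.zero_le _
  | _ + 1 => (min_le_right _ _).trans (Nat.sub_le _ _)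

theorem add_succ_le (k : ℕ) (a : ℕ → ℕ) (i : ℕ) :
    greedySel k a i + greedySel k a (i + 1) ≤ k := by
  have h1 := le_bound k a i
  have h2 : greedySel k a (i + 1) ≤ k - greedySel k a i := min_le_right _ _
  omega

theorem sum_le {k : ℕ} {a b : ℕ → ℕ} (hba : ∀ i, b i ≤ a i) (hb : ∀ i, b i + b (i + 1) ≤ k)
    (n : ℕ) : ∑ i ∈ Finset.range n, b i ≤ ∑ i ∈ Finset.range n, greedySel k a (i + 1) := by
  induction n using Nat.strong_induction_on with
  | _ n ih =>
    match n with
    | 0 => simp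
    | 1 =>
      have h0 := hb 0
      have h1 := hba 0
      simp only [Finset.sum_range_one, greedySel]
      omega
    | n + 2 =>
      have h1 := ih n (by omega)
      have h2 := ih (n + 1) (by omega)
      have h3 := hb n
      have h4 := hba (n + 1)
      have h5 : greedySel k a (n + 1 + 1) = min (a (n + 1)) (k - greedySel k a (n + 1)) := rfl
      rw [Finset.sum_range_succ, Finset.sum_range_succ] at h2
      rw [Finset.sum_range_succ, Finset.sum_range_succ, Finset.sum_range_succ,
        Finset.sum_range_succ]
      omega

theorem succ_bound (k : ℕ) (a : ℕ → ℕ) (i : ℕ) :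
    greedySel k a i ≤ greedySel (k + 1) a i ∧ greedySel (k + 1) a i ≤ greedySel k a i + 1 := by
  induction i with
  | zero => simp [greedySel]
  | succ i ih =>
    simp only [greedySel]
    omega

theorem mono (a : ℕ → ℕ) (i : ℕ) : Monotone fun k => greedySel k a i :=
  monotone_nat_of_le_succ fun k => (succ_bound k a i).1

theorem congr_of_eq_below {k : ℕ} {a b : ℕ → ℕ} {i : ℕ} (h : ∀ j < i, a j = b j) :
    ∀ j ≤ i, greedySel k a j = greedySel k b j := by
  intro j
  induction j with
  | zero => intro _; rfl
  | succ j ih =>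
    intro hj
    simp only [greedySel]
    rw [h j (by omega), ih (by omega)]

theorem zero_bound (a : ℕ → ℕ) (i : ℕ) : greedySel 0 a i = 0 :=
  Nat.le_zero.1 (le_bound 0 a i)

end greedySel

/-- Exponents `a`, supported below `n`, whose greedy selections have total size at least that of
the partial sums of `t`, with equality of the total degree. -/
def GreedyDominates (n p : ℕ) (t a : ℕ → ℕ) : Prop :=
  ∑ i ∈ Finset.range n, a i = ∑ l ∈ Finset.range p, t l ∧
    ∀ k ≤ p, ∑ l ∈ Finset.range k, t l ≤ ∑ i ∈ Finset.range n, greedySel k a (i + 1)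

/-- One variable `x_j` of `v` may be traded for an `x_i` with `i < j` whenever `i` is the first
place where `v` differs from a lexicographically larger `u`. -/
theorem GreedyDominates.exchange {n p : ℕ} {t u v : ℕ → ℕ} (hu : GreedyDominates n p t u)
    (hv : GreedyDominates n p t v) {i : ℕ} (hin : i < n) (hlt : v i < u i)
    (heq : ∀ j < i, u j = v j) :
    ∃ j, i < j ∧ j < n ∧ 0 < v j ∧
      GreedyDominates n p t (fun m => (if m = i then v m + 1 else if m = j then v m - 1 else v m)) := by
  classical
  let bad : ℕ → Prop := fun k =>
    ∑ i ∈ Finset.range n, greedySel k v (i + 1) ≤ ∑ l ∈ Finset.range k, t l ∧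
      greedySel k v i + greedySel k v (i + 1) = k
  have bad0 : bad 0 := by simp [bad, greedySel.zero_bound]
  obtain ⟨k, hkp, ⟨hk1, hk2⟩, hkmax⟩ : ∃ k ≤ p, bad k ∧ ∀ k', k < k' → k' ≤ p → ¬ bad k' :=
    ⟨Nat.findGreatest bad p, Nat.findGreatest_le p,
      Nat.findGreatest_spec (Nat.zero_le p) bad0,
      fun k' h1 h2 => Nat.findGreatest_is_greatest h1 h2⟩
  have hex : ∃ j, i < j ∧ j < n ∧ greedySel k v (j + 1) < v j := by
    by_contra! hcon
    have hG : ∀ j ≤ i, greedySel k u j = greedySel k v j := greedySel.congr_of_eq_below heq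
    have hGi : greedySel k u (i + 1) = greedySel k v (i + 1) := by
      have := hG i le_rfl
      simp only [greedySel] at hk2 ⊢
      omega
    have key : ∑ m ∈ Finset.range n, (v m + greedySel k u (m + 1)) <
        ∑ m ∈ Finset.range n, (u m + greedySel k v (m + 1)) := by
      refine Finset.sum_lt_sum (fun m hm => ?_) ⟨i, Finset.mem_range.2 hin, by omega⟩
      rcases lt_trichotomy m i with h | rfl | h
      · rw [heq m h, hG (m + 1) h]
      · omega
      · have h1 := hcon m h (Finset.mem_range.1 hm)
        have h2 := greedySel.le_apply k u m
        omega
    rw [Finset.sum_add_distrib, Finset.sum_add_distrib, hu.1, hv.1] at key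
    have := hu.2 k hkp
    omega
  let j := Nat.find hex
  obtain ⟨hij, hjn, hj⟩ : i < j ∧ j < n ∧ greedySel k v (j + 1) < v j := Nat.find_spec hex
  have hjmin : ∀ m, i < m → m < j → v m = greedySel k v (m + 1) := fun m h1 h2 => by
    have h3 := Nat.find_min hex h2
    have h4 := greedySel.le_apply k v m
    by_contra h5
    exact h3 ⟨h1, by omega, by omega⟩
  have hsum : ∀ f : ℕ → ℕ, 0 < f j →
      ∑ m ∈ Finset.range n, (if m = i then f m + 1 else if m = j then f m - 1 else f m) =
        ∑ m ∈ Finset.range n, f m := fun f hf => by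
    have h1 : ∀ m, (if m = i then f m + 1 else if m = j then f m - 1 else f m) +
        (if m = j then 1 else 0) = f m + (if m = i then 1 else 0) := by
      intro m
      by_cases h : m = i
      · simp [h, hij.ne]
      · by_cases h' : m = j
        · subst h'; simp [h]; omega
        · simp [h, h']
    have h2 := Finset.sum_congr (rfl : Finset.range n = Finset.range n) fun m _ => h1 m
    rw [Finset.sum_add_distrib, Finset.sum_add_distrib, Finset.sum_ite_eq', Finset.sum_ite_eq',
      if_pos (Finset.mem_range.2 hin), if_pos (Finset.mem_range.2 hjn)] at h2
    omega
  refine ⟨j, hij, hjn, by omega, (hsum v (by omega)).trans hv.1, fun k' hk' => ?_⟩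
  have hvk := hv.2 k' hk'
  have hle := greedySel.le_apply k' v
  have hadd := greedySel.add_succ_le k' v
  rcases le_or_gt k' k with h | h
  · refine hvk.trans (greedySel.sum_le (fun m => ?_) (fun m => hadd (m + 1)) n)
    have h1 := hle m
    have h2 : greedySel k' v (m + 1) ≤ greedySel k v (m + 1) := greedySel.mono v (m + 1) h
    split_ifs with h3 h4
    · omega
    · subst h4; omega
    · exact h1
  by_cases hsat : greedySel k' v i + greedySel k' v (i + 1) = k'
  · have hnt : ∑ l ∈ Finset.range k', t l < ∑ m ∈ Finset.range n, greedySel k' v (m + 1) := by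
      by_contra hc
      exact hkmax k' h hk' ⟨not_lt.1 hc, hsat⟩
    have h1 : ∑ m ∈ Finset.range n, greedySel k' v (m + 1) ≤
        ∑ m ∈ Finset.range n, (greedySel k' v (m + 1) - if m = j then 1 else 0) + 1 := by
      have : ∑ m ∈ Finset.range n, (if m = j then 1 else 0) = 1 := by
        rw [Finset.sum_ite_eq', if_pos (Finset.mem_range.2 hjn)]
      have h := Finset.sum_le_sum fun m (_ : m ∈ Finset.range n) =>
        (by omega : greedySel k' v (m + 1) ≤
          (greedySel k' v (m + 1) - if m = j then 1 else 0) + if m = j then 1 else 0)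
      rwa [Finset.sum_add_distrib, this] at h
    have h2 := greedySel.sum_le (k := k')
      (a := fun m => (if m = i then v m + 1 else if m = j then v m - 1 else v m))
      (b := fun m => greedySel k' v (m + 1) - if m = j then 1 else 0)
      (fun m => by have := hle m; split_ifs <;> omega)
      (fun m => by have := hadd (m + 1); omega) n
    omega
  · have hsat' := hadd i
    have hm1 : greedySel k v i ≤ greedySel k' v i := greedySel.mono v i h.le
    rcases Nat.eq_zero_or_pos (greedySel k' v (j + 1)) with h0 | h0
    · refine hvk.trans (greedySel.sum_le (fun m => ?_) (fun m => hadd (m + 1)) n)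
      have h1 := hle m
      split_ifs with h3 h4
      · omega
      · subst h4; omega
      · exact h1
    · rw [← hsum (fun m => greedySel k' v (m + 1)) h0] at hvk
      refine hvk.trans (greedySel.sum_le (fun m => ?_) (fun m => ?_) n)
      · have h1 := hle m
        split_ifs <;> omega
      · have h1 := hadd (m + 1)
        have h2 : m + 1 = i → greedySel k' v (m + 1) = greedySel k' v i := fun h => by rw [h]
        have h3 : m + 1 = i → greedySel k' v (m + 1 + 1) = greedySel k' v (i + 1) :=
          fun h => by rw [h]
        have h4 : m = i → greedySel k' v (m + 1) = greedySel k' v (i + 1) := fun h => by rw [h]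
        have h5 : m = i → m + 1 ≠ j → greedySel k' v (m + 1) + greedySel k' v (m + 1 + 1) < k' := by
          rintro rfl hne
          have h6 := hjmin (m + 1) (by omega) (by omega)
          have h7 := hle (m + 1)
          have h8 := greedySel.add_succ_le k v (m + 1)
          omega
        have h6 : m + 1 = j → greedySel k' v (m + 1 + 1) = greedySel k' v (j + 1) :=
          fun h => by rw [h]
        split_ifs <;> omega

/-- Two finite sets without consecutive elements whose sizes differ by at least two can be
rebalanced by one, preserving multiplicities. -/
theorem exists_balance {A B : Finset ℕ} (hA : ∀ i ∈ A, i + 1 ∉ A) (hB : ∀ i ∈ B, i + 1 ∉ B)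
    (hAB : B.card + 2 ≤ A.card) :
    ∃ A' B' : Finset ℕ, (∀ i ∈ A', i + 1 ∉ A') ∧ (∀ i ∈ B', i + 1 ∉ B') ∧
      A'.card + 1 = A.card ∧ B'.card = B.card + 1 ∧
      ∀ i, (if i ∈ A' then 1 else 0) + (if i ∈ B' then 1 else 0) =
        (if i ∈ A then 1 else 0) + (if i ∈ B then 1 else 0) := by
  classical
  let f : ℕ → Finset ℕ → ℕ := fun c S => (S.filter (c ≤ ·)).card
  have hstep : ∀ c S, f c S = f (c + 1) S + if c ∈ S then 1 else 0 := by
    intro c S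
    have : S.filter (c ≤ ·) = S.filter (c + 1 ≤ ·) ∪ (S.filter (c = ·)) := by
      ext x; simp only [Finset.mem_filter, Finset.mem_union]
      rw [← and_or_left]; refine and_congr_right fun _ => ?_; omega
    simp only [f]
    rw [this, Finset.card_union_of_disjoint, Finset.filter_eq]
    · split_ifs <;> simp
    · rw [Finset.disjoint_left]; intro x hx hx'
      simp only [Finset.mem_filter] at hx hx'; omega
  have hcompl : ∀ c S, (S.filter (· < c)).card + f c S = S.card := by
    intro c S
    have := Finset.card_filter_add_card_filter_not (s := S) (· < c)
    simpa only [not_lt] using this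
  let M := A.sup id + 1
  have hM : f M A = 0 := by
    simp only [f, Finset.card_eq_zero, Finset.filter_eq_empty_iff]
    intro x hx
    have : id x ≤ A.sup id := Finset.le_sup hx
    simp only [id] at this; omega
  have h0 : f 0 B + 2 ≤ f 0 A := by simpa [f] using hAB
  let P : ℕ → Prop := fun c => f c B + 2 ≤ f c A
  obtain ⟨c, hc, hcmax⟩ : ∃ c, P c ∧ ∀ c', c < c' → ¬ P c' := by
    refine ⟨Nat.findGreatest P M, Nat.findGreatest_spec (Nat.zero_le M) h0, fun c' h1 h2 => ?_⟩
    by_cases h3 : c' ≤ M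
    · exact Nat.findGreatest_is_greatest h1 h3 h2
    · have h4 : f c' A ≤ f M A := Finset.card_le_card
        (Finset.monotone_filter_right _ fun x _ hx => by omega)
      simp only [P] at h2; omega
  have h1 := hcmax (c + 1) (by omega)
  have h2 := hcmax (c + 1 + 1) (by omega)
  have sA := hstep c A
  have sB := hstep c B
  have sA1 := hstep (c + 1) A
  have sB1 := hstep (c + 1) B
  simp only [P] at hc h1 h2
  have hcA : c ∈ A := by by_contra h; simp only [h, if_false] at sA; omega
  have hcB : c ∉ B := by intro h; simp only [h, hcA, if_true] at sA sB; omega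
  have hcA1 : c + 1 ∉ A := hA c hcA
  simp only [hcA, hcB, hcA1, if_true, if_false] at sA sB sA1
  have hcB1 : c + 1 ∉ B := by
    intro h; simp only [h, if_true] at sB1; omega
  have hcard : ∀ S T : Finset ℕ, (S.filter (· < c + 1) ∪ T.filter (c + 1 ≤ ·)).card =
      (S.filter (· < c + 1)).card + f (c + 1) T := fun S T => by
    refine Finset.card_union_of_disjoint (Finset.disjoint_left.2 fun x hx hx' => ?_)
    simp only [Finset.mem_filter] at hx hx'; omega
  have hch : ∀ S T : Finset ℕ, (∀ i ∈ S, i + 1 ∉ S) → (∀ i ∈ T, i + 1 ∉ T) → c + 1 ∉ T →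
      ∀ i ∈ S.filter (· < c + 1) ∪ T.filter (c + 1 ≤ ·),
        i + 1 ∉ S.filter (· < c + 1) ∪ T.filter (c + 1 ≤ ·) := by
    intro S T hS hT hc i hi hi'
    simp only [Finset.mem_filter, Finset.mem_union] at hi hi'
    rcases hi with ⟨a1, a2⟩ | ⟨a1, a2⟩ <;> rcases hi' with ⟨b1, b2⟩ | ⟨b1, b2⟩
    · exact hS i a1 b1
    · have : i = c := by omega
      subst this; exact hc b1
    · omega
    · exact hT i a1 b1
  refine ⟨A.filter (· < c + 1) ∪ B.filter (c + 1 ≤ ·), B.filter (· < c + 1) ∪ A.filter (c + 1 ≤ ·),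
    hch A B hA hB hcB1, hch B A hB hA hcA1, ?_, ?_, fun i => ?_⟩
  · have := hcompl (c + 1) A
    rw [hcard]; omega
  · have := hcompl (c + 1) B
    rw [hcard]; omega
  · simp only [Finset.mem_filter, Finset.mem_union]
    by_cases h : i < c + 1
    · simp [h, Nat.not_le.2 h]
    · simp [h, Nat.not_lt.1 h, add_comm]

/-- A decomposition of the exponents `a` into `p` chains, the `l`-th of size `t l`. -/
def ChainDecomposable (p : ℕ) (t a : ℕ → ℕ) : Prop :=
  ∃ s : ℕ → Finset ℕ, (∀ l < p, ∀ i ∈ s l, i + 1 ∉ s l) ∧ (∀ l < p, (s l).card = t l) ∧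
    ∀ i, a i = ∑ l ∈ Finset.range p, if i ∈ s l then 1 else 0

theorem ChainDecomposable.greedyDominates {n p : ℕ} {t a : ℕ → ℕ} (h : ChainDecomposable p t a)
    (ha : ∀ i, n ≤ i → a i = 0) : GreedyDominates n p t a := by
  classical
  obtain ⟨s, hs, hc, hsum⟩ := h
  have hsub : ∀ l < p, s l ⊆ Finset.range n := by
    intro l hl i hi
    by_contra hin
    have h0 := ha i (by simpa using hin)
    rw [hsum i, Finset.sum_eq_zero_iff] at h0
    simpa [hi] using h0 l (Finset.mem_range.2 hl)
  have hk : ∀ k ≤ p, ∑ l ∈ Finset.range k, t l =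
      ∑ i ∈ Finset.range n, ∑ l ∈ Finset.range k, if i ∈ s l then 1 else 0 := by
    intro k hk
    rw [Finset.sum_comm]
    refine Finset.sum_congr rfl fun l hl => ?_
    have hl' : l < p := (Finset.mem_range.1 hl).trans_le hk
    rw [← hc l hl', Finset.sum_boole, Nat.cast_id, Finset.filter_mem_eq_inter,
      Finset.inter_eq_right.2 (hsub l hl')]
  refine ⟨?_, fun k hkp => ?_⟩
  · rw [hk p le_rfl]
    exact Finset.sum_congr rfl fun i _ => hsum i
  · rw [hk k hkp]
    refine greedySel.sum_le (fun i => ?_) (fun i => ?_) n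
    · rw [hsum i]
      exact Finset.sum_le_sum_of_subset (Finset.range_subset_range.2 hkp)
    · rw [← Finset.sum_add_distrib]
      calc _ ≤ ∑ l ∈ Finset.range k, 1 := Finset.sum_le_sum fun l hl => ?_
        _ = k := by simp
      have := hs l ((Finset.mem_range.1 hl).trans_le hkp) i
      by_cases h1 : i ∈ s l
      · simp [h1, this h1]
      · simp only [h1, if_false]; split_ifs <;> omega

theorem chainDecomposable_of_partial_sums {p : ℕ} {t a : ℕ → ℕ} (ht : Antitone t)
    (s : ℕ → Finset ℕ) (hs : ∀ l < p, ∀ i ∈ s l, i + 1 ∉ s l)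
    (hsum : ∀ i, a i = ∑ l ∈ Finset.range p, if i ∈ s l then 1 else 0)
    (hle : ∀ k ≤ p, ∑ l ∈ Finset.range k, t l ≤ ∑ l ∈ Finset.range k, (s l).card)
    (htot : ∑ l ∈ Finset.range p, (s l).card = ∑ l ∈ Finset.range p, t l) :
    ChainDecomposable p t a := by
  classical
  induction hN : ∑ k ∈ Finset.range (p + 1), ∑ l ∈ Finset.range k, (s l).card
    using Nat.strong_induction_on generalizing s with
  | _ N ih =>
  by_cases hall : ∀ l < p, (s l).card = t l
  · exact ⟨s, hs, hall, hsum⟩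
  push Not at hall
  let x := Nat.find hall
  obtain ⟨hxp, hx⟩ : x < p ∧ (s x).card ≠ t x := Nat.find_spec hall
  have hxmin : ∀ l < x, (s l).card = t l := fun l hl => by
    have := Nat.find_min hall hl
    by_contra h
    exact this ⟨hl.trans hxp, h⟩
  have hxsum : ∑ l ∈ Finset.range x, (s l).card = ∑ l ∈ Finset.range x, t l :=
    Finset.sum_congr rfl fun l hl => hxmin l (Finset.mem_range.1 hl)
  have hxgt : t x < (s x).card := by
    have := hle (x + 1) hxp
    rw [Finset.sum_range_succ, Finset.sum_range_succ, hxsum] at this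
    omega
  have hexy : ∃ y, y < p ∧ (s y).card < t y := by
    by_contra! hcon
    have : ∑ l ∈ Finset.range p, t l < ∑ l ∈ Finset.range p, (s l).card :=
      Finset.sum_lt_sum (fun l hl => hcon l (Finset.mem_range.1 hl))
        ⟨x, Finset.mem_range.2 hxp, hxgt⟩
    omega
  let y := Nat.find hexy
  obtain ⟨hyp, hy⟩ : y < p ∧ (s y).card < t y := Nat.find_spec hexy
  have hymin : ∀ l < y, t l ≤ (s l).card := fun l hl => by
    have := Nat.find_min hexy hl
    by_contra h
    exact this ⟨hl.trans hyp, not_le.1 h⟩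
  have hxy : x < y := by
    rcases lt_trichotomy x y with h | h | h
    · exact h
    · rw [← h] at hy; omega
    · have := hxmin y h; omega
  have htxy := ht hxy.le
  obtain ⟨A, B, hA, hB, hAc, hBc, hmul⟩ := exists_balance (hs x hxp) (hs y hyp) (by omega)
  let s' : ℕ → Finset ℕ := fun l => if l = x then A else if l = y then B else s l
  have hs_x : s' x = A := by simp [s']
  have hs_y : s' y = B := by simp [s', hxy.ne']
  have hs_other : ∀ l, l ≠ x → l ≠ y → s' l = s l := fun l h1 h2 => by simp [s', h1, h2]
  have hcard : ∀ l, (s' l).card + (if l = x then 1 else 0) =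
      (s l).card + (if l = y then 1 else 0) := by
    intro l
    by_cases h : l = x
    · rw [h, hs_x]; simp [hxy.ne, hAc]
    · by_cases h' : l = y
      · rw [h', hs_y]; simp [hxy.ne', hBc]
      · rw [hs_other l h h']; simp [h, h']
  have hpart : ∀ k, ∑ l ∈ Finset.range k, (s' l).card + (if x < k then 1 else 0) =
      ∑ l ∈ Finset.range k, (s l).card + (if y < k then 1 else 0) := by
    intro k
    have := Finset.sum_congr (rfl : Finset.range k = Finset.range k) fun l _ => hcard l
    rw [Finset.sum_add_distrib, Finset.sum_add_distrib, Finset.sum_ite_eq',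
      Finset.sum_ite_eq'] at this
    simpa only [Finset.mem_range] using this
  refine ih _ ?_ s' ?_ ?_ ?_ ?_ rfl
  · rw [← hN]
    refine Finset.sum_lt_sum (fun k _ => ?_) ⟨x + 1, Finset.mem_range.2 (by omega), ?_⟩
    · have := hpart k; split_ifs at this <;> omega
    · have := hpart (x + 1); split_ifs at this <;> omega
  · intro l hl
    by_cases h : l = x
    · rw [h, hs_x]; exact hA
    · by_cases h' : l = y
      · rw [h', hs_y]; exact hB
      · rw [hs_other l h h']; exact hs l hl
  · intro i
    rw [hsum i]
    have hxm : x ∈ Finset.range p := Finset.mem_range.2 hxp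
    have hym : y ∈ (Finset.range p).erase x :=
      Finset.mem_erase.2 ⟨hxy.ne', Finset.mem_range.2 hyp⟩
    rw [← Finset.add_sum_erase _ _ hxm, ← Finset.add_sum_erase _ _ hym,
      ← Finset.add_sum_erase _ _ hxm, ← Finset.add_sum_erase _ _ hym, ← add_assoc, ← add_assoc,
      hs_x, hs_y, hmul i]
    congr 1
    refine Finset.sum_congr rfl fun l hl => ?_
    simp only [Finset.mem_erase] at hl
    rw [hs_other l hl.2.1 hl.1]
  · intro k hk
    have h1 := hpart k
    have h2 := hle k hk
    by_cases hxk : x < k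
    · by_cases hyk : y < k
      · simp only [hxk, hyk, if_true] at h1; omega
      · simp only [hxk, hyk, if_true, if_false] at h1
        have : ∑ l ∈ Finset.range k, t l < ∑ l ∈ Finset.range k, (s l).card :=
          Finset.sum_lt_sum (fun l hl => hymin l (by have := Finset.mem_range.1 hl; omega))
            ⟨x, Finset.mem_range.2 hxk, hxgt⟩
        omega
    · split_ifs at h1 <;> omega
  · have := hpart p
    simp only [hxp, hyp, if_true] at this
    omega

theorem GreedyDominates.chainDecomposable {n p : ℕ} {t a : ℕ → ℕ} (ht : Antitone t)
    (ha : ∀ i, n ≤ i → a i = 0) (h : GreedyDominates n p t a) : ChainDecomposable p t a := by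
  classical
  let s : ℕ → Finset ℕ := fun l =>
    (Finset.range n).filter fun i => greedySel l a (i + 1) < greedySel (l + 1) a (i + 1)
  have hind : ∀ l i, i < n → greedySel (l + 1) a (i + 1) =
      greedySel l a (i + 1) + if i ∈ s l then 1 else 0 := by
    intro l i hi
    have := greedySel.succ_bound l a (i + 1)
    simp only [s, Finset.mem_filter, Finset.mem_range, hi, true_and]
    split_ifs <;> omega
  have hG : ∀ i < n, ∀ k, greedySel k a (i + 1) =
      ∑ l ∈ Finset.range k, if i ∈ s l then 1 else 0 := by
    intro i hi k
    induction k with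
    | zero => simp [greedySel.zero_bound]
    | succ k ih => rw [Finset.sum_range_succ, hind k i hi, ih]
  have hcard : ∀ k, ∑ l ∈ Finset.range k, (s l).card =
      ∑ i ∈ Finset.range n, greedySel k a (i + 1) := by
    intro k
    rw [Finset.sum_congr rfl fun i hi => hG i (Finset.mem_range.1 hi) k, Finset.sum_comm]
    refine Finset.sum_congr rfl fun l _ => ?_
    rw [Finset.sum_boole, Nat.cast_id, Finset.filter_mem_eq_inter,
      Finset.inter_eq_right.2 (Finset.filter_subset _ _)]
  have hfull : ∀ i ∈ Finset.range n, greedySel p a (i + 1) = a i := by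
    refine (Finset.sum_eq_sum_iff_of_le fun i _ => greedySel.le_apply p a i).1 ?_
    refine le_antisymm (Finset.sum_le_sum fun i _ => greedySel.le_apply p a i) ?_
    rw [h.1]; exact h.2 p le_rfl
  refine chainDecomposable_of_partial_sums ht s ?_ ?_ ?_ ?_
  · intro l _ i hi hi'
    simp only [s, Finset.mem_filter, Finset.mem_range] at hi hi'
    have h1 := hi.2
    have h2 := hi'.2
    simp only [greedySel] at h1 h2
    omega
  · intro i
    by_cases hi : i < n
    · rw [← hfull i (Finset.mem_range.2 hi), hG i hi]
    · rw [ha i (not_lt.1 hi)]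
      refine (Finset.sum_eq_zero fun l _ => if_neg ?_).symm
      simp [s, hi]
  · intro k hk
    rw [hcard]; exact h.2 k hk
  · rw [hcard, Finset.sum_congr rfl hfull, h.1]

open Finsupp in
/-- A set of exponents of equal degree satisfying a lexicographic exchange property spans a
monomial ideal with linear quotients. -/
theorem hasLinearQuotients_of_exchange {K : Type} [Field K] {n d : ℕ} {B : Set (Fin n →₀ ℕ)}
    (hd : ∀ m ∈ B, m.degree = d)
    (hex : ∀ u ∈ B, ∀ v ∈ B, ∀ i, (∀ j < i, u j = v j) → v i < u i →
      ∃ w ∈ B, ∃ j, i < j ∧ w + single j 1 = v + single i 1) :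
    HasLinearQuotients (Ideal.span ((fun s => monomial s (1 : K)) '' B)) := by
  classical
  have hfin : B.Finite := (Finsupp.finite_of_degree_le d).subset fun m hm => (hd m hm).le
  let S : Finset (Lex (Fin n →₀ ℕ))ᵒᵈ :=
    hfin.toFinset.map (toLex.trans OrderDual.toDual).toEmbedding
  let e := S.orderEmbOfFin rfl
  let m : Fin S.card → Fin n →₀ ℕ := fun t => ofLex (OrderDual.ofDual (e t))
  have hrange : Set.range m = B := by
    have h : Set.range e = S := Finset.range_orderEmbOfFin S rfl
    ext x
    constructor
    · rintro ⟨t, rfl⟩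
      have h1 : e t ∈ (S : Set _) := h ▸ Set.mem_range_self t
      obtain ⟨y, hy, hy'⟩ := Finset.mem_map.1 (Finset.mem_coe.1 h1)
      have : m t = y := by simp only [m, ← hy']; rfl
      rw [this]
      exact hfin.mem_toFinset.1 hy
    · intro hx
      have h1 : OrderDual.toDual (toLex x) ∈ (S : Set _) :=
        Finset.mem_coe.2 (Finset.mem_map.2 ⟨x, hfin.mem_toFinset.2 hx, rfl⟩)
      rw [← h] at h1
      obtain ⟨t, ht⟩ := h1
      exact ⟨t, by simp only [m, ht]; rfl⟩
  have hmB : ∀ t, m t ∈ B := fun t => hrange ▸ Set.mem_range_self t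
  have hlt : ∀ t t', t' < t ↔ ∃ i, (∀ j < i, m t j = m t' j) ∧ m t i < m t' i := fun t t' => by
    rw [← e.lt_iff_lt, ← OrderDual.ofDual_lt_ofDual, Finsupp.Lex.lt_iff]
  have himage : ∀ s : Set (Fin S.card), (fun t => monomial (m t) (1 : K)) '' s =
      (fun s => monomial s (1 : K)) '' (m '' s) := fun s => by rw [Set.image_image]
  refine ⟨S.card, fun t => monomial (m t) 1, fun _ => d,
    fun t => isHomogeneous_monomial _ (hd _ (hmB t)), fun t => by simp, ?_, fun t => ?_,
    fun t => ?_⟩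
  · rw [← Set.image_univ, himage, Set.image_univ, hrange]
  · rw [himage, mem_ideal_span_monomial_image]
    intro h
    obtain ⟨_, ⟨t', ht', rfl⟩, hle⟩ := h (m t) (by simp [MvPolynomial.mem_support_iff])
    refine ht' ?_
    obtain ⟨c, hc⟩ := exists_add_of_le hle
    have h1 := congrArg Finsupp.degree hc
    rw [map_add, hd _ (hmB t), hd _ (hmB t')] at h1
    have h2 : c = 0 := (Finsupp.degree_eq_zero_iff c).1 (by omega)
    rw [h2, add_zero] at hc
    exact e.injective (by simpa [m] using hc.symm)
  · let T : Set (Fin n) := {i | ∃ t' < t, m t' ≤ m t + single i 1}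
    refine ⟨X '' T, ?_, ?_⟩
    · rintro _ ⟨i, _, rfl⟩
      exact isHomogeneous_X K i
    · ext f
      rw [Ideal.mem_colon_span_singleton, himage, mem_ideal_span_monomial_image,
        mem_ideal_span_X_image]
      have hsupp : ∀ x, x ∈ (f * monomial (m t) 1).support ↔ ∃ y ∈ f.support, x = y + m t := by
        intro x
        rw [MvPolynomial.mem_support_iff, coeff_mul_monomial', mul_one]
        constructor
        · intro h
          by_cases hle : m t ≤ x
          · rw [if_pos hle] at h
            exact ⟨x - m t, MvPolynomial.mem_support_iff.2 h, (tsub_add_cancel_of_le hle).symm⟩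
          · rw [if_neg hle] at h; exact absurd rfl h
        · rintro ⟨y, hy, rfl⟩
          rw [if_pos le_add_self, add_tsub_cancel_right]
          exact MvPolynomial.mem_support_iff.1 hy
      constructor
      · intro h x hx
        obtain ⟨_, ⟨t', ht', rfl⟩, hle⟩ := h (x + m t) ((hsupp _).2 ⟨x, hx, rfl⟩)
        obtain ⟨i, hi1, hi2⟩ := (hlt t t').1 ht'
        obtain ⟨w, hw, j, hij, hwv⟩ := hex _ (hmB t') _ (hmB t) i (fun j hj => (hi1 j hj).symm) hi2
        have hwl : ∀ l, l ≠ j → w l = m t l + single i 1 l := fun l hl => by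
          have := DFunLike.congr_fun hwv l
          simpa [Finsupp.single_apply, hl.symm] using this
        rw [← hrange] at hw
        obtain ⟨t'', rfl⟩ := hw
        refine ⟨i, ⟨t'', (hlt t t'').2 ⟨i, fun l hl => ?_, ?_⟩, ?_⟩, ?_⟩
        · rw [hwl l (hl.trans hij).ne, Finsupp.single_eq_of_ne hl.ne, add_zero]
        · rw [hwl i hij.ne, Finsupp.single_eq_same]; omega
        · rw [← hwv]; exact le_self_add
        · have := hle i
          rw [Finsupp.add_apply] at this
          omega
      · intro h x hx
        obtain ⟨y, hy, rfl⟩ := (hsupp x).1 hx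
        obtain ⟨i, ⟨t', ht', hle⟩, hi⟩ := h y hy
        refine ⟨m t', ⟨t', ht', rfl⟩, hle.trans ?_⟩
        rw [add_comm]
        refine add_le_add_left ?_ _
        rw [Finsupp.single_le_iff]
        omega

/-- The exponents of `m`, extended by zero to all natural numbers. -/
def natExponents {n : ℕ} (m : Fin n →₀ ℕ) (i : ℕ) : ℕ :=
  if h : i < n then m ⟨i, h⟩ else 0

theorem natExponents_val {n : ℕ} (m : Fin n →₀ ℕ) (i : Fin n) : natExponents m i = m i := by
  simp [natExponents]

theorem natExponents_of_le {n : ℕ} (m : Fin n →₀ ℕ) (i : ℕ) (h : n ≤ i) :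
    natExponents m i = 0 := by
  simp [natExponents, h]

open Finsupp in
theorem ChainDecomposable.exists_exchange {n p : ℕ} {t : ℕ → ℕ} (ht : Antitone t)
    {u v : Fin n →₀ ℕ} (hu : ChainDecomposable p t (natExponents u))
    (hv : ChainDecomposable p t (natExponents v)) (i : Fin n) (heq : ∀ j < i, u j = v j)
    (hlt : v i < u i) :
    ∃ w : Fin n →₀ ℕ, ChainDecomposable p t (natExponents w) ∧
      ∃ j, i < j ∧ w + single j 1 = v + single i 1 := by
  obtain ⟨j, hij, hjn, hj, hw⟩ := (hu.greedyDominates (natExponents_of_le u)).exchange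
    (hv.greedyDominates (natExponents_of_le v)) i.2
    (by rwa [natExponents_val, natExponents_val]) (fun j hj => by
      have hj' : j < n := hj.trans i.2
      have := heq ⟨j, hj'⟩ hj
      simpa [natExponents, hj'] using this)
  lift j to Fin n using hjn
  rw [natExponents_val] at hj
  have hle : single j 1 ≤ v + single i 1 :=
    (Finsupp.single_le_iff.2 hj).trans le_self_add
  refine ⟨v + single i 1 - single j 1, ?_, j, hij, tsub_add_cancel_of_le hle⟩
  convert hw.chainDecomposable ht ?_ using 1
  · funext l
    by_cases hl : l < n
    · have hne : i ≠ j := fun h => by simp [h] at hij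
      lift l to Fin n using hl
      simp only [natExponents_val, Finsupp.tsub_apply, Finsupp.add_apply, Finsupp.single_apply,
        Fin.val_inj]
      by_cases h1 : l = i
      · subst h1; simp [hne.symm]
      · by_cases h2 : l = j
        · subst h2; simp [h1, hne]
        · simp [h1, h2, Ne.symm h1, Ne.symm h2]
    · have h1 : l ≠ i := fun h => hl (h ▸ i.2)
      have h2 : l ≠ j := fun h => hl (h ▸ j.2)
      simp [natExponents_of_le _ l (not_lt.1 hl), h1, h2]
  · intro l hl
    have h1 : l ≠ i := by have := i.2; omega
    have h2 : l ≠ j := by have := j.2; omega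
    simp [natExponents_of_le _ l hl, h1, h2]

theorem prod_span_chains (K : Type) [Field K] (n p : ℕ) (t : ℕ → ℕ) :
    ∏ l : Fin p, Ideal.span { f : MvPolynomial (Fin n) K |
        ∃ s : Finset (Fin n), s.card = t l ∧
          (∀ i ∈ s, ∀ j ∈ s, i < j → (i : ℕ) + 2 ≤ (j : ℕ)) ∧ f = ∏ i ∈ s, X i } =
      Ideal.span ((fun s => monomial s (1 : K)) ''
        {m : Fin n →₀ ℕ | ChainDecomposable p t (natExponents m)}) := by
  classical
  have hmon : ∀ s : Fin p → Finset (Fin n), ∏ l, ∏ i ∈ s l, (X i : MvPolynomial (Fin n) K) =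
      monomial (∑ l, ∑ i ∈ s l, Finsupp.single i 1) 1 := by
    intro s
    simp only [monomial_sum_one]
    rfl
  have happ : ∀ (s : Fin p → Finset (Fin n)) (i : Fin n),
      (∑ l, ∑ i ∈ s l, Finsupp.single i 1 : Fin n →₀ ℕ) i = ∑ l, if i ∈ s l then 1 else 0 := by
    intro s i
    simp [Finsupp.finsetSum_apply, Finsupp.single_apply]
  rw [Ideal.prod_span]
  congr 1
  ext f
  rw [Set.mem_fintype_prod]
  constructor
  · rintro ⟨g, hg, rfl⟩
    choose s hcard hchain hgs using hg
    refine ⟨∑ l, ∑ i ∈ s l, Finsupp.single i 1, ?_, ?_⟩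
    · refine ⟨fun l => if h : l < p then (s ⟨l, h⟩).map Fin.valEmbedding else ∅, ?_, ?_, ?_⟩
      · intro l hl i hi hi'
        simp only [hl, dif_pos, Finset.mem_map, Fin.valEmbedding_apply] at hi hi'
        obtain ⟨a, ha, rfl⟩ := hi
        obtain ⟨b, hb, hab⟩ := hi'
        have := hchain _ a ha b hb (by rw [Fin.lt_def]; omega)
        omega
      · intro l hl
        simp [hl, hcard]
      · intro i
        rw [Finset.sum_range]
        by_cases hi : i < n
        · lift i to Fin n using hi
          rw [natExponents_val, happ]
          refine Finset.sum_congr rfl fun l _ => ?_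
          simp [Fin.val_inj]
        · rw [natExponents_of_le _ i (not_lt.1 hi)]
          refine (Finset.sum_eq_zero fun l _ => if_neg ?_).symm
          simp only [l.2, dif_pos, Finset.mem_map, Fin.valEmbedding_apply]
          rintro ⟨a, _, rfl⟩
          exact hi a.2
    · simp only [hgs, hmon]
  · rintro ⟨m, ⟨s, hchain, hcard, hsum⟩, rfl⟩
    have hsub : ∀ l : Fin p, ∀ i ∈ s l, i < n := by
      intro l i hi
      by_contra hin
      have h0 := natExponents_of_le m i (not_lt.1 hin)
      rw [hsum i, Finset.sum_eq_zero_iff] at h0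
      simpa [hi] using h0 l (Finset.mem_range.2 l.2)
    refine ⟨fun l => ∏ i ∈ (s l).attachFin (hsub l), X i, fun l =>
      ⟨(s l).attachFin (hsub l), ?_, fun i hi j hj hij => ?_, rfl⟩, ?_⟩
    · rw [Finset.card_attachFin, hcard l l.2]
    · rw [Finset.mem_attachFin] at hi hj
      have h1 := hchain l l.2 i hi
      have h2 : (i : ℕ) + 1 ≠ j := fun h => h1 (h ▸ hj)
      have h3 : (i : ℕ) < j := hij
      omega
    · rw [hmon]
      refine congrArg (monomial · 1) (Finsupp.ext fun i => ?_)
      rw [happ, ← natExponents_val m i, hsum, Finset.sum_range]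
      simp [Finset.mem_attachFin]

/-- **Proposition 6.2**: let `J_k` be the monomial ideal generated by the
`>₁`-chains of degree `k`, i.e. the squarefree monomials `x_{i_1} ⋯ x_{i_k}` with
`i_{l+1} - i_l ≥ 2` for all `l`.  Then any product `J = J_{t_1} ⋯ J_{t_p}` has
linear quotients. -/
theorem statement_19 (K : Type) [Field K] (n : ℕ)
    (Jk : ℕ → Ideal (MvPolynomial (Fin n) K))
    (hJk : ∀ k : ℕ, Jk k = Ideal.span { f : MvPolynomial (Fin n) K |
        ∃ s : Finset (Fin n), s.card = k ∧
          (∀ i ∈ s, ∀ j ∈ s, i < j → (i : ℕ) + 2 ≤ (j : ℕ)) ∧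
          f = ∏ i ∈ s, X i })
    (p : ℕ) (t : Fin p → ℕ) :
    HasLinearQuotients (∏ l, Jk (t l)) := by
  let σ : Equiv.Perm (Fin p) := Tuple.sort (OrderDual.toDual ∘ t)
  let t' : ℕ → ℕ := fun l => if h : l < p then t (σ ⟨l, h⟩) else 0
  have ht' : Antitone t' := by
    intro a b hab
    by_cases hb : b < p
    · have ha : a < p := hab.trans_lt hb
      have h : (⟨a, ha⟩ : Fin p) ≤ ⟨b, hb⟩ := hab
      have := Tuple.monotone_sort (OrderDual.toDual ∘ t) h
      simpa [t', ha, hb] using this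
    · simp [t', hb]
  have hprod : ∏ l, Jk (t l) = ∏ l : Fin p, Jk (t' l) := by
    rw [← Equiv.prod_comp σ]
    exact Finset.prod_congr rfl fun l _ => by simp [t']
  rw [hprod]
  simp only [hJk]
  rw [prod_span_chains]
  refine hasLinearQuotients_of_exchange (d := ∑ l ∈ Finset.range p, t' l) (fun m hm => ?_)
    fun u hu v hv i heq hlt => ChainDecomposable.exists_exchange ht' hu hv i heq hlt
  rw [← (hm.greedyDominates (natExponents_of_le m)).1, Finset.sum_range, Finsupp.degree_eq_sum]
  exact Finset.sum_congr rfl fun i _ => (natExponents_val m i).symm
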